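/- arXiv:1004.0273 — 3 statements merged into one kernel-verified Lean document; each statement's English description precedes it below -/
import Mathlib

section
/- Let Q be an n×n Hermitian positive definite complex matrix and Δ an n×n Hermitian positive semidefinite complex matrix, and suppose ‖Q⁻¹‖⁻¹ − ‖Δ‖ > 0 in the ℓ²-operator norm. Then Q − Δ is positive definite (hence invertible) and ‖Q⁻¹ − (Q − Δ)⁻¹‖ ≤ ‖Q⁻¹‖ * ‖Δ‖ / (‖Q⁻¹‖⁻¹ − ‖Δ‖). (This is the norm estimate established in the proof of the paper's theorem bounding the corrupted topological filter, using ‖(Q−Δ)⁻¹‖ = 1/min sp(Q−Δ) and min sp(Q−Δ) ≥ min sp(Q) − max sp(Δ).) -/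
open Matrix
open scoped ComplexOrder Matrix.Norms.L2Operator

open scoped MatrixOrder in
theorem posDef_sub_aux {n : ℕ} (Q Δ : Matrix (Fin n) (Fin n) ℂ)
    (hQ : Q.PosDef) (hΔ : Δ.PosSemidef)
    (hgap : 0 < ‖Q⁻¹‖⁻¹ - ‖Δ‖) : (Q - Δ).PosDef := by
  have hq : 0 < ‖Q⁻¹‖ := by
    have := norm_nonneg Δ
    exact inv_pos.mp (by linarith)
  have hdet : IsUnit Q.det := (Matrix.isUnit_iff_isUnit_det _).mp hQ.isUnit
  let a : (Matrix (Fin n) (Fin n) ℂ)ˣ :=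
    ⟨Q⁻¹, Q, Matrix.nonsing_inv_mul _ hdet, Matrix.mul_nonsing_inv _ hdet⟩
  let b : (Matrix (Fin n) (Fin n) ℂ)ˣ :=
    ⟨algebraMap ℝ _ ‖Q⁻¹‖, algebraMap ℝ _ ‖Q⁻¹‖⁻¹,
      by rw [← map_mul, mul_inv_cancel₀ hq.ne', map_one],
      by rw [← map_mul, inv_mul_cancel₀ hq.ne', map_one]⟩
  have h1 : algebraMap ℝ (Matrix (Fin n) (Fin n) ℂ) ‖Q⁻¹‖⁻¹ ≤ Q := by
    have := CStarAlgebra.inv_le_inv (a := a) (b := b)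
      (Matrix.nonneg_iff_posSemidef.mpr hQ.inv.posSemidef)
      (IsSelfAdjoint.le_algebraMap_norm_self (a := Q⁻¹) hQ.inv.isHermitian)
    exact this
  have h2 : Δ ≤ algebraMap ℝ (Matrix (Fin n) (Fin n) ℂ) ‖Δ‖ :=
    IsSelfAdjoint.le_algebraMap_norm_self (a := Δ) hΔ.isHermitian
  have h3 : algebraMap ℝ (Matrix (Fin n) (Fin n) ℂ) (‖Q⁻¹‖⁻¹ - ‖Δ‖) ≤ Q - Δ := by
    rw [map_sub]; exact sub_le_sub h1 h2
  have h4 : (algebraMap ℝ (Matrix (Fin n) (Fin n) ℂ) (‖Q⁻¹‖⁻¹ - ‖Δ‖)).PosDef := by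
    rw [Algebra.algebraMap_eq_smul_one]
    exact Matrix.PosDef.one.smul hgap
  have h5 := h4.add_posSemidef (Matrix.le_iff.mp h3)
  simpa using h5

theorem stmt_15 {n : ℕ} (Q Δ : Matrix (Fin n) (Fin n) ℂ)
    (hQ : Q.PosDef) (hΔ : Δ.PosSemidef)
    (hgap : 0 < ‖Q⁻¹‖⁻¹ - ‖Δ‖) :
    (Q - Δ).PosDef ∧
      ‖Q⁻¹ - (Q - Δ)⁻¹‖ ≤ ‖Q⁻¹‖ * ‖Δ‖ / (‖Q⁻¹‖⁻¹ - ‖Δ‖) := by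
  have hP := posDef_sub_aux Q Δ hQ hΔ hgap
  refine ⟨hP, ?_⟩
  have hq : 0 < ‖Q⁻¹‖ := by
    have := norm_nonneg Δ
    exact inv_pos.mp (by linarith)
  have hdQ : IsUnit Q.det := (Matrix.isUnit_iff_isUnit_det _).mp hQ.isUnit
  have hdP : IsUnit (Q - Δ).det := (Matrix.isUnit_iff_isUnit_det _).mp hP.isUnit
  have key : Q⁻¹ * Δ * (Q - Δ)⁻¹ = (Q - Δ)⁻¹ - Q⁻¹ := by
    have e : Δ = Q - (Q - Δ) := by abel
    calc Q⁻¹ * Δ * (Q - Δ)⁻¹ = Q⁻¹ * (Q - (Q - Δ)) * (Q - Δ)⁻¹ := by rw [← e]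
      _ = (Q⁻¹ * Q) * (Q - Δ)⁻¹ - Q⁻¹ * ((Q - Δ) * (Q - Δ)⁻¹) := by
        rw [mul_sub, sub_mul, mul_assoc Q⁻¹ (Q - Δ)]
      _ = _ := by
        rw [Matrix.nonsing_inv_mul _ hdQ, Matrix.mul_nonsing_inv _ hdP, one_mul, mul_one]
  have hb : ‖(Q - Δ)⁻¹ - Q⁻¹‖ ≤ ‖Q⁻¹‖ * ‖Δ‖ * ‖(Q - Δ)⁻¹‖ := by
    rw [← key]
    exact (norm_mul_le _ _).trans (by gcongr; exact norm_mul_le _ _)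
  have hr : ‖(Q - Δ)⁻¹‖ ≤ ‖Q⁻¹‖ + ‖Q⁻¹‖ * ‖Δ‖ * ‖(Q - Δ)⁻¹‖ := by
    have := norm_sub_norm_le (Q - Δ)⁻¹ Q⁻¹
    linarith
  have hr2 : ‖(Q - Δ)⁻¹‖ * (‖Q⁻¹‖⁻¹ - ‖Δ‖) ≤ 1 := by
    have h : ‖Q⁻¹‖ * (‖(Q - Δ)⁻¹‖ * (‖Q⁻¹‖⁻¹ - ‖Δ‖)) ≤ ‖Q⁻¹‖ * 1 := by
      have : ‖Q⁻¹‖ * (‖(Q - Δ)⁻¹‖ * (‖Q⁻¹‖⁻¹ - ‖Δ‖))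
          = ‖(Q - Δ)⁻¹‖ - ‖Q⁻¹‖ * ‖Δ‖ * ‖(Q - Δ)⁻¹‖ := by
        field_simp
      linarith
    exact le_of_mul_le_mul_left h hq
  rw [norm_sub_rev, le_div_iff₀ hgap]
  calc _ ≤ ‖Q⁻¹‖ * ‖Δ‖ * ‖(Q - Δ)⁻¹‖ * (‖Q⁻¹‖⁻¹ - ‖Δ‖) := by gcongr
    _ = ‖Q⁻¹‖ * ‖Δ‖ * (‖(Q - Δ)⁻¹‖ * (‖Q⁻¹‖⁻¹ - ‖Δ‖)) := by ring
    _ ≤ ‖Q⁻¹‖ * ‖Δ‖ * 1 := by gcongr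
    _ = _ := mul_one _
end

section
/- Let Φx be an n×n Hermitian positive definite complex matrix (the noise-free output spectral density at a fixed frequency), Φη an n×n Hermitian positive semidefinite complex matrix (the measurement-noise spectral density), and set Φy := Φx + Φη. Let c be a 1×n complex row matrix, and define the topological filter row W := c * Φx⁻¹ and the corrupted topological filter row Ŵ := c * Φy⁻¹. If ‖Φy⁻¹‖⁻¹ − ‖Φη‖ > 0 in the ℓ²-operator norm, then ‖Ŵ − W‖ ≤ ‖c‖ * ‖Φy⁻¹‖ * ‖Φη‖ / (‖Φy⁻¹‖⁻¹ − ‖Φη‖). (This is the paper's robustness theorem for corrupted linear dynamic graphs, stated at a fixed frequency, using that the cross-spectrum of the measured signals equals that of the noise-free signals since the measurement noises are uncorrelated with the outputs.) -/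
open Matrix
open scoped ComplexOrder Matrix.Norms.L2Operator

theorem stmt_16 {n : ℕ} (Φx Φη : Matrix (Fin n) (Fin n) ℂ)
    (hx : Φx.PosDef) (hη : Φη.PosSemidef)
    (Φy : Matrix (Fin n) (Fin n) ℂ) (hy : Φy = Φx + Φη)
    (c : Matrix (Fin 1) (Fin n) ℂ)
    (W : Matrix (Fin 1) (Fin n) ℂ) (hW : W = c * Φx⁻¹)
    (Wc : Matrix (Fin 1) (Fin n) ℂ) (hWc : Wc = c * Φy⁻¹)
    (hgap : 0 < ‖Φy⁻¹‖⁻¹ - ‖Φη‖) :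
    ‖Wc - W‖ ≤ ‖c‖ * ‖Φy⁻¹‖ * ‖Φη‖ / (‖Φy⁻¹‖⁻¹ - ‖Φη‖) := by
  subst hy hW hWc
  have hyp : (Φx + Φη).PosDef := hx.add_posSemidef hη
  have ux : IsUnit Φx.det := (Matrix.isUnit_iff_isUnit_det _).1 hx.isUnit
  have uy : IsUnit (Φx + Φη).det := (Matrix.isUnit_iff_isUnit_det _).1 hyp.isUnit
  have key : (Φx + Φη)⁻¹ - Φx⁻¹ = -((Φx + Φη)⁻¹ * Φη * Φx⁻¹) := by
    have h1 : (Φx + Φη)⁻¹ * (Φx + Φη) * Φx⁻¹ = Φx⁻¹ := by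
      rw [Matrix.nonsing_inv_mul _ uy, one_mul]
    have h2 : (Φx + Φη)⁻¹ * Φx * Φx⁻¹ = (Φx + Φη)⁻¹ := by
      rw [mul_assoc, Matrix.mul_nonsing_inv _ ux, mul_one]
    rw [mul_add, add_mul, h2] at h1
    generalize (Φx + Φη)⁻¹ = Y at *
    rw [← h1, sub_add_cancel_left, h1]
  generalize (Φx + Φη)⁻¹ = Y at *
  generalize Φx⁻¹ = X at *
  have hprod : ‖Y * Φη * X‖ ≤ ‖Y‖ * ‖Φη‖ * ‖X‖ :=
    (l2_opNorm_mul _ _).trans (mul_le_mul_of_nonneg_right (l2_opNorm_mul _ _) (norm_nonneg _))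
  have hX : ‖X‖ ≤ ‖Y‖ + ‖Y‖ * ‖Φη‖ * ‖X‖ := by
    have : X = Y + Y * Φη * X := by
      rw [← sub_eq_iff_eq_add', ← neg_sub, key, neg_neg]
    calc ‖X‖ = ‖Y + Y * Φη * X‖ := by rw [← this]
      _ ≤ ‖Y‖ + ‖Y * Φη * X‖ := norm_add_le _ _
      _ ≤ _ := by gcongr
  have he := norm_nonneg Φη
  have ha : 0 < ‖Y‖ := inv_pos.1 (by linarith)
  have hx1 : ‖X‖ * (‖Y‖⁻¹ - ‖Φη‖) ≤ 1 := by
    have h : ‖Y‖⁻¹ * ‖X‖ ≤ ‖Y‖⁻¹ * (‖Y‖ + ‖Y‖ * ‖Φη‖ * ‖X‖) := by gcongr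
    have h3 : ‖Y‖⁻¹ * (‖Y‖ + ‖Y‖ * ‖Φη‖ * ‖X‖) = 1 + ‖Φη‖ * ‖X‖ := by
      field_simp
    rw [h3] at h
    linarith
  rw [← Matrix.mul_sub, key, le_div_iff₀ hgap]
  have h4 : ‖c * -(Y * Φη * X)‖ ≤ ‖c‖ * (‖Y‖ * ‖Φη‖ * ‖X‖) := by
    refine (l2_opNorm_mul _ _).trans ?_
    rw [norm_neg]
    gcongr
  calc _ ≤ ‖c‖ * (‖Y‖ * ‖Φη‖ * ‖X‖) * (‖Y‖⁻¹ - ‖Φη‖) := by gcongr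
    _ = ‖c‖ * ‖Y‖ * ‖Φη‖ * (‖X‖ * (‖Y‖⁻¹ - ‖Φη‖)) := by ring
    _ ≤ ‖c‖ * ‖Y‖ * ‖Φη‖ * 1 := by gcongr
    _ = _ := mul_one _
end

section
/- Let Φx be an n×n Hermitian positive definite complex matrix, Φη an n×n Hermitian positive semidefinite complex matrix, Φy := Φx + Φη, and c a 1×n complex row matrix. Assume ‖Φy⁻¹‖⁻¹ − ‖Φη‖ > 0 in the ℓ²-operator norm. Then for every index i, if |(c * Φy⁻¹) 0 i| > ‖c‖ * ‖Φy⁻¹‖ * ‖Φη‖ / (‖Φy⁻¹‖⁻¹ − ‖Φη‖), then (c * Φx⁻¹) 0 i ≠ 0. (This is the paper's corollary on robust link detection: if an entry of the corrupted topological filter exceeds the perturbation bound, the corresponding entry of the uncorrupted topological filter is nonzero, hence—by the sparsity theorem—the corresponding pair of nodes is a kin pair of the underlying graph.) -/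
open Matrix
open scoped ComplexOrder Matrix.Norms.L2Operator

theorem entry_le_l2 {n : ℕ} (A : Matrix (Fin 1) (Fin n) ℂ) (i : Fin n) : ‖A 0 i‖ ≤ ‖A‖ := by
  have h := l2_opNorm_mulVec A (EuclideanSpace.single i (1 : ℂ))
  have h2 := PiLp.norm_apply_le
    (WithLp.toLp 2 (A *ᵥ (EuclideanSpace.single i (1 : ℂ)).ofLp) : EuclideanSpace ℂ (Fin 1)) 0
  have h3 := h2.trans h
  simpa using h3

theorem stmt_17 {n : ℕ} (Φx Φη : Matrix (Fin n) (Fin n) ℂ)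
    (hx : Φx.PosDef) (hη : Φη.PosSemidef)
    (Φy : Matrix (Fin n) (Fin n) ℂ) (hy : Φy = Φx + Φη)
    (c : Matrix (Fin 1) (Fin n) ℂ)
    (hgap : 0 < ‖Φy⁻¹‖⁻¹ - ‖Φη‖) :
    ∀ i : Fin n,
      ‖c‖ * ‖Φy⁻¹‖ * ‖Φη‖ / (‖Φy⁻¹‖⁻¹ - ‖Φη‖) < ‖(c * Φy⁻¹) 0 i‖ →
      (c * Φx⁻¹) 0 i ≠ 0 := by
  intro i hi h0
  have hyp : Φy.PosDef := hy ▸ hx.add_posSemidef hη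
  have ux : Φx⁻¹ * Φx = 1 := nonsing_inv_mul _ ((isUnit_iff_isUnit_det _).1 hx.isUnit)
  have uy : Φy * Φy⁻¹ = 1 := mul_nonsing_inv _ ((isUnit_iff_isUnit_det _).1 hyp.isUnit)
  have key : Φx⁻¹ = Φy⁻¹ + Φx⁻¹ * Φη * Φy⁻¹ := by
    have e : Φη = Φy - Φx := by rw [hy]; abel
    rw [e, mul_sub, ux, sub_mul, mul_assoc, uy]
    simp
  have hh : 0 ≤ ‖Φη‖ := norm_nonneg _
  have hp : 0 < ‖Φy⁻¹‖ := inv_pos.1 (by linarith)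
  have b1 : ‖Φx⁻¹ * Φη * Φy⁻¹‖ ≤ ‖Φx⁻¹‖ * ‖Φη‖ * ‖Φy⁻¹‖ :=
    (l2_opNorm_mul _ _).trans (by gcongr; exact l2_opNorm_mul _ _)
  have b2 : ‖Φx⁻¹‖ ≤ ‖Φy⁻¹‖ + ‖Φx⁻¹‖ * ‖Φη‖ * ‖Φy⁻¹‖ := by
    calc ‖Φx⁻¹‖ = ‖Φy⁻¹ + Φx⁻¹ * Φη * Φy⁻¹‖ := by rw [← key]
      _ ≤ _ := (norm_add_le _ _).trans (by gcongr)
  have b3 : ‖Φx⁻¹‖ * (‖Φy⁻¹‖⁻¹ - ‖Φη‖) ≤ 1 := by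
    have e : ‖Φx⁻¹‖ * (‖Φy⁻¹‖⁻¹ - ‖Φη‖)
        = (‖Φx⁻¹‖ - ‖Φx⁻¹‖ * ‖Φη‖ * ‖Φy⁻¹‖) / ‖Φy⁻¹‖ := by field_simp
    rw [e, div_le_one hp]; linarith
  have e1 : (c * Φy⁻¹) 0 i = - (c * (Φx⁻¹ * Φη * Φy⁻¹)) 0 i := by
    rw [key, Matrix.mul_add, Matrix.add_apply] at h0
    exact eq_neg_of_add_eq_zero_left h0
  have b4 : ‖(c * Φy⁻¹) 0 i‖ ≤ ‖c‖ * (‖Φx⁻¹‖ * ‖Φη‖ * ‖Φy⁻¹‖) := by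
    rw [e1, norm_neg]
    exact (entry_le_l2 _ i).trans ((l2_opNorm_mul _ _).trans (by gcongr))
  rw [div_lt_iff₀ hgap] at hi
  have b5 : ‖(c * Φy⁻¹) 0 i‖ * (‖Φy⁻¹‖⁻¹ - ‖Φη‖) ≤ ‖c‖ * ‖Φy⁻¹‖ * ‖Φη‖ := by
    calc _ ≤ ‖c‖ * (‖Φx⁻¹‖ * ‖Φη‖ * ‖Φy⁻¹‖) * (‖Φy⁻¹‖⁻¹ - ‖Φη‖) := by gcongr
      _ = (‖c‖ * ‖Φy⁻¹‖ * ‖Φη‖) * (‖Φx⁻¹‖ * (‖Φy⁻¹‖⁻¹ - ‖Φη‖)) := by ring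
      _ ≤ _ := mul_le_of_le_one_right (by positivity) b3
  linarith
end
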